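/- arXiv:2011.08962 — 2 statements merged into one kernel-verified Lean document; each statement's English description precedes it below -/
import Mathlib

section
/- Let (V, ω) be a symplectic vector space, and let ν, τ, L1, L2 be Lagrangian subspaces such that τ, L1 and L2 are each transverse to ν. Assume L1 ≺_ν L2 (with respect to the polarization (L2, ν)), and assume that either τ ≺_ν L1 (with respect to (L1, ν)) or L2 ≺_ν τ (with respect to (τ, ν)). Then L1 and L2 are each transverse to τ, and L1 ≺_τ L2 (with respect to the polarization (L2, τ)). -/
open Module

variable {V : Type*} [AddCommGroup V] [Module ℝ V]

/-- The `ω`-orthogonal complement of a subspace `W`: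
`W^⊥ = {v ∈ V : ω(v, x) = 0 for all x ∈ W}`. -/
def SympOrtho (ω : V →ₗ[ℝ] V →ₗ[ℝ] ℝ) (W : Submodule ℝ V) : Submodule ℝ V :=
  ⨅ x ∈ W, LinearMap.ker (ω.flip x)

/-- A symplectic form: a nondegenerate alternating bilinear form. -/
def IsSymplectic (ω : V →ₗ[ℝ] V →ₗ[ℝ] ℝ) : Prop :=
  (∀ v : V, (∀ w : V, ω v w = 0) → v = 0) ∧ ∀ v : V, ω v v = 0

/-- A subspace is Lagrangian if it equals its `ω`-orthogonal complement. -/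
def IsLagrangian (ω : V →ₗ[ℝ] V →ₗ[ℝ] ℝ) (L : Submodule ℝ V) : Prop :=
  SympOrtho ω L = L

/-- `PosRel ω X Y Z` says `X ≻_Z Y` (with respect to the polarization `(Y, Z)`):
for every nonzero `x ∈ Y` and every `m ∈ Z` with `x + m ∈ X` (such an `m` exists and
is unique since `V = X ⊕ Z`), one has `ω(m, x) > 0`; i.e. the quadratic form
`X^{(Y,Z)}` is positive definite. -/
def PosRel (ω : V →ₗ[ℝ] V →ₗ[ℝ] ℝ) (X Y Z : Submodule ℝ V) : Prop :=
  ∀ x ∈ Y, x ≠ 0 → ∀ m ∈ Z, x + m ∈ X → 0 < ω m x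

/-- `NegRel ω X Y Z` says `X ≺_Z Y`: the quadratic form `X^{(Y,Z)}` is negative
definite. -/
def NegRel (ω : V →ₗ[ℝ] V →ₗ[ℝ] ℝ) (X Y Z : Submodule ℝ V) : Prop :=
  ∀ x ∈ Y, x ≠ 0 → ∀ m ∈ Z, x + m ∈ X → ω m x < 0

theorem IsLagrangian.apply_eq_zero {ω : V →ₗ[ℝ] V →ₗ[ℝ] ℝ} {L : Submodule ℝ V}
    (hL : IsLagrangian ω L) {v w : V} (hv : v ∈ L) (hw : w ∈ L) : ω v w = 0 := by
  rw [← hL] at hv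
  simp only [SympOrtho, Submodule.mem_iInf, LinearMap.mem_ker, LinearMap.flip_apply] at hv
  exact hv w hw

theorem IsLagrangian.mem_of_forall {ω : V →ₗ[ℝ] V →ₗ[ℝ] ℝ} {L : Submodule ℝ V}
    (hL : IsLagrangian ω L) {v : V} (hv : ∀ w ∈ L, ω v w = 0) : v ∈ L := by
  rw [← hL]
  simpa only [SympOrtho, Submodule.mem_iInf, LinearMap.mem_ker, LinearMap.flip_apply] using hv

/-- Two transverse Lagrangian subspaces span the whole space. -/
theorem IsLagrangian.sup_eq_top [FiniteDimensional ℝ V] {ω : V →ₗ[ℝ] V →ₗ[ℝ] ℝ}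
    (hω : IsSymplectic ω) {L M : Submodule ℝ V} (hL : IsLagrangian ω L)
    (hM : IsLagrangian ω M) (hLM : L ⊓ M = ⊥) : L ⊔ M = ⊤ := by
  by_contra h
  obtain ⟨f, hf, hle⟩ := Submodule.exists_le_ker_of_lt_top _ (lt_top_iff_ne_top.mpr h)
  have hinj : Function.Injective ω := by
    rw [← LinearMap.ker_eq_bot, LinearMap.ker_eq_bot']
    intro v hv
    exact hω.1 v fun w => by rw [hv, LinearMap.zero_apply]
  have hsurj : Function.Surjective ω :=
    (LinearMap.injective_iff_surjective_of_finrank_eq_finrank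
      (Subspace.dual_finrank_eq (K := ℝ) (V := V)).symm).mp hinj
  obtain ⟨v, rfl⟩ := hsurj f
  have hvL : v ∈ L := hL.mem_of_forall fun w hw => hle (Submodule.mem_sup_left hw)
  have hvM : v ∈ M := hM.mem_of_forall fun w hw => hle (Submodule.mem_sup_right hw)
  have hv : v = 0 := Submodule.disjoint_def.mp (disjoint_iff.mpr hLM) v hvL hvM
  exact hf (by rw [hv, map_zero])

theorem IsLagrangian.exists_add_eq [FiniteDimensional ℝ V] {ω : V →ₗ[ℝ] V →ₗ[ℝ] ℝ}
    (hω : IsSymplectic ω) {L M : Submodule ℝ V} (hL : IsLagrangian ω L)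
    (hM : IsLagrangian ω M) (hLM : L ⊓ M = ⊥) (v : V) : ∃ x ∈ L, ∃ m ∈ M, x + m = v :=
  Submodule.mem_sup.mp (hL.sup_eq_top hω hM hLM ▸ Submodule.mem_top)

/-- Let ν, τ, L1, L2 be Lagrangian subspaces with τ, L1, L2 each transverse to ν.
Assume L1 ≺_ν L2 (w.r.t. (L2, ν)) and either τ ≺_ν L1 (w.r.t. (L1, ν)) or
L2 ≺_ν τ (w.r.t. (τ, ν)). Then L1 and L2 are each transverse to τ, and
L1 ≺_τ L2 (w.r.t. the polarization (L2, τ)). -/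
theorem lagrangian_neg_change_of_pole [FiniteDimensional ℝ V]
    (ω : V →ₗ[ℝ] V →ₗ[ℝ] ℝ) (hω : IsSymplectic ω)
    (ν τ L₁ L₂ : Submodule ℝ V)
    (hν : IsLagrangian ω ν) (hτ : IsLagrangian ω τ)
    (hL₁ : IsLagrangian ω L₁) (hL₂ : IsLagrangian ω L₂)
    (hτν : τ ⊓ ν = ⊥) (hL₁ν : L₁ ⊓ ν = ⊥) (hL₂ν : L₂ ⊓ ν = ⊥)
    (h12 : NegRel ω L₁ L₂ ν)
    (hside : NegRel ω τ L₁ ν ∨ NegRel ω L₂ τ ν) :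
    L₁ ⊓ τ = ⊥ ∧ L₂ ⊓ τ = ⊥ ∧ NegRel ω L₁ L₂ τ := by
  have disj {A B : Submodule ℝ V} (h : A ⊓ B = ⊥) {v : V} (ha : v ∈ A) (hb : v ∈ B) : v = 0 :=
    Submodule.disjoint_def.mp (disjoint_iff.mpr h) v ha hb
  have swap (v w : V) : ω w v = -ω v w := by
    have h := hω.2 (v + w)
    simp only [map_add, LinearMap.add_apply, hω.2] at h
    linarith
  rcases hside with hside | hside
  · refine ⟨?_, ?_, ?_⟩
    · refine (Submodule.eq_bot_iff _).mpr fun w hw => ?_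
      by_contra hw0
      simpa using hside w hw.1 hw0 0 ν.zero_mem (by simpa using hw.2)
    · refine (Submodule.eq_bot_iff _).mpr fun w ⟨hw₂, hwτ⟩ => ?_
      by_contra hw0
      obtain ⟨l, hl, k, hk, rfl⟩ := hL₁.exists_add_eq hω hν hL₁ν w
      have hl0 : l ≠ 0 := by
        rintro rfl
        exact hw0 (disj hτν hwτ (by simpa using hk))
      have h₁ := h12 _ hw₂ hw0 (-k) (ν.neg_mem hk) (by simpa using hl)
      have h₂ := hside l hl hl0 k hk hwτ
      simp only [map_add, map_neg, LinearMap.neg_apply, hω.2] at h₁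
      linarith
    · intro x hx hx0 m hm hxm
      obtain ⟨y, hy, n, hn, rfl⟩ := hL₂.exists_add_eq hω hν hL₂ν m
      obtain ⟨l, hl, k, hk, hlk⟩ := hL₁.exists_add_eq hω hν hL₁ν y
      have hnk : n + k ∈ ν := ν.add_mem hn hk
      have hxl : x + (n + k) ∈ L₁ := by
        have : x + (n + k) = x + (y + n) - l := by rw [← hlk]; abel
        rw [this]
        exact L₁.sub_mem hxm hl
      have h₁ := h12 x hx hx0 (n + k) hnk hxl
      have h₂ : ω (n + k) l ≤ 0 := by
        by_cases hl0 : l = 0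
        · simp [hl0]
        · refine (hside l hl hl0 (n + k) hnk ?_).le
          have : l + (n + k) = y + n := by rw [← hlk]; abel
          rwa [this]
      have h₃ := hL₁.apply_eq_zero hl hxl
      have h₄ := hL₂.apply_eq_zero hy hx
      have h₅ := swap l (n + k)
      rw [map_add] at h₃
      rw [← hlk] at h₄ ⊢
      simp only [map_add, LinearMap.add_apply] at h₁ h₂ h₃ h₄ h₅ ⊢
      linarith
  · refine ⟨?_, ?_, ?_⟩
    · refine (Submodule.eq_bot_iff _).mpr fun w ⟨hw₁, hwτ⟩ => ?_
      by_contra hw0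
      obtain ⟨y, hy, n, hn, rfl⟩ := hL₂.exists_add_eq hω hν hL₂ν w
      have hy0 : y ≠ 0 := by
        rintro rfl
        exact hw0 (disj hτν hwτ (by simpa using hn))
      have h₁ := h12 y hy hy0 n hn hw₁
      have h₂ := hside _ hwτ hw0 (-n) (ν.neg_mem hn) (by simpa using hy)
      simp only [map_add, map_neg, LinearMap.neg_apply, hω.2] at h₂
      linarith
    · refine (Submodule.eq_bot_iff _).mpr fun w hw => ?_
      by_contra hw0
      simpa using hside w hw.2 hw0 0 ν.zero_mem (by simpa using hw.1)
    · intro x hx hx0 m hm hxm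
      obtain ⟨y, hy, n, hn, rfl⟩ := hL₂.exists_add_eq hω hν hL₂ν m
      have hmem : x + y + n ∈ L₁ := by rwa [add_assoc]
      have h₁ : y + n ≠ 0 → 0 < ω n y := fun h0 => by
        have h := hside _ hm h0 (-n) (ν.neg_mem hn) (by simpa using hy)
        simp only [map_add, map_neg, LinearMap.neg_apply, hω.2] at h
        linarith
      have h₂ : x + y ≠ 0 → ω n (x + y) < 0 := fun h0 =>
        h12 _ (L₂.add_mem hx hy) h0 n hn hmem
      have h₄ := hL₂.apply_eq_zero hy hx
      by_cases hu : x + y = 0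
      · have hn0 : n = 0 := disj hL₁ν (by simpa [hu] using hmem) hn
        have hy0 : y ≠ 0 := by
          rintro rfl
          exact hx0 (by simpa using hu)
        simpa [hn0] using h₁ (by simpa [hn0] using hy0)
      · have h₃ := h₂ hu
        by_cases hm0 : y + n = 0
        · have hn0 : n = 0 :=
            disj hL₂ν (by rw [eq_neg_of_add_eq_zero_right hm0]; exact L₂.neg_mem hy) hn
          simp [hn0] at h₃
        · have h₅ := h₁ hm0
          simp only [map_add, LinearMap.add_apply] at h₃ ⊢
          linarith
end

section
/- Let (V, ω) be a symplectic vector space of dimension 2n, (τ, ν) a polarization of V, L a Lagrangian subspace transverse to ν, and W a coisotropic subspace with ν ⊆ W. Then: (a) W^⊥ ⊆ ν, and the quotient map W → W/W^⊥ restricts to a linear isomorphism of τ ∩ W onto [τ]^W; (b) [τ]^W and [ν]^W are transverse Lagrangian subspaces of the reduction [V]^W, and [L]^W is a Lagrangian subspace of [V]^W transverse to [ν]^W; (c) for every x ∈ τ ∩ W, ([L]^W)^{([τ]^W,[ν]^W)}(x + W^⊥) = L^{(τ,ν)}(x); i.e., under the isomorphism of (a), the quadratic form of the reduced Lagrangian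 [L]^W with respect to the polarization ([τ]^W, [ν]^W) equals the restriction of L^{(τ,ν)} to τ ∩ W. -/
open Module

variable {V : Type*} [AddCommGroup V] [Module ℝ V]

/-- The preimage in `W` of the symplectic reduction `[S]^W = ((S ∩ W) + W^⊥)/W^⊥`:
the subspace `(S ⊓ W) + W^⊥` of `V`. -/
def RedSub (ω : V →ₗ[ℝ] V →ₗ[ℝ] ℝ) (W S : Submodule ℝ V) : Submodule ℝ V :=
  (S ⊓ W) ⊔ SympOrtho ω W

/-- `[S]^W` is a Lagrangian subspace of the reduction `[V]^W = W/W^⊥`: the preimage of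
`[S]^W` in `W` coincides with the preimage of its ω̄-orthogonal complement, namely
`W ⊓ (RedSub ω W S)^⊥`. -/
def RedLagrangian (ω : V →ₗ[ℝ] V →ₗ[ℝ] ℝ) (W S : Submodule ℝ V) : Prop :=
  RedSub ω W S = W ⊓ SympOrtho ω (RedSub ω W S)

/-- `[S]^W` and `[T]^W` are transverse in the reduction `[V]^W`: the intersection of
their preimages in `W` is exactly `W^⊥` (the kernel of the projection `W → W/W^⊥`). -/
def RedTransverse (ω : V →ₗ[ℝ] V →ₗ[ℝ] ℝ) (W S T : Submodule ℝ V) : Prop :=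
  RedSub ω W S ⊓ RedSub ω W T = SympOrtho ω W

/-- `RedPosRel ω W X Y Z` says `[X]^W ≻_{[Z]^W} [Y]^W` in the reduction `[V]^W`:
for every `x` representing a nonzero element of `[Y]^W` and every `m` representing an
element of `[Z]^W` with `x̄ + m̄ ∈ [X]^W`, one has `ω̄(m̄, x̄) = ω(m, x) > 0`. -/
def RedPosRel (ω : V →ₗ[ℝ] V →ₗ[ℝ] ℝ) (W X Y Z : Submodule ℝ V) : Prop :=
  ∀ x ∈ RedSub ω W Y, x ∉ SympOrtho ω W →
    ∀ m ∈ RedSub ω W Z, x + m ∈ RedSub ω W X → 0 < ω m x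

theorem mem_sympOrtho {ω : V →ₗ[ℝ] V →ₗ[ℝ] ℝ} {W : Submodule ℝ V} {v : V} :
    v ∈ SympOrtho ω W ↔ ∀ x ∈ W, ω v x = 0 := by
  simp [SympOrtho]

theorem sympOrtho_anti (ω : V →ₗ[ℝ] V →ₗ[ℝ] ℝ) {S T : Submodule ℝ V} (h : S ≤ T) :
    SympOrtho ω T ≤ SympOrtho ω S :=
  fun _ hv => mem_sympOrtho.2 fun x hx => mem_sympOrtho.1 hv x (h hx)

theorem sympOrtho_sup (ω : V →ₗ[ℝ] V →ₗ[ℝ] ℝ) (S T : Submodule ℝ V) :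
    SympOrtho ω (S ⊔ T) = SympOrtho ω S ⊓ SympOrtho ω T := by
  refine le_antisymm (le_inf (sympOrtho_anti ω le_sup_left) (sympOrtho_anti ω le_sup_right)) ?_
  rintro v ⟨hS, hT⟩
  refine mem_sympOrtho.2 fun x hx => ?_
  obtain ⟨s, hs, t, ht, rfl⟩ := Submodule.mem_sup.1 hx
  rw [map_add, mem_sympOrtho.1 hS s hs, mem_sympOrtho.1 hT t ht, add_zero]

theorem sympOrtho_eq_orthogonal {ω : V →ₗ[ℝ] V →ₗ[ℝ] ℝ} (hω : IsSymplectic ω)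
    (W : Submodule ℝ V) : SympOrtho ω W = LinearMap.BilinForm.orthogonal ω W := by
  have hr : LinearMap.IsRefl ω := LinearMap.IsAlt.isRefl hω.2
  ext v
  exact mem_sympOrtho.trans
    ⟨fun h x hx => hr _ _ (h x hx), fun h x hx => hr _ _ (h x hx)⟩

theorem sympOrtho_sympOrtho [FiniteDimensional ℝ V] {ω : V →ₗ[ℝ] V →ₗ[ℝ] ℝ}
    (hω : IsSymplectic ω) (W : Submodule ℝ V) : SympOrtho ω (SympOrtho ω W) = W := by
  have hr : LinearMap.IsRefl ω := LinearMap.IsAlt.isRefl hω.2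
  rw [sympOrtho_eq_orthogonal hω, sympOrtho_eq_orthogonal hω]
  exact LinearMap.BilinForm.orthogonal_orthogonal
    (hr.nondegenerate_iff_separatingLeft.2 hω.1) hr W

/-- Symplectic reduction along a coisotropic subspace preserves Lagrangian subspaces. -/
theorem IsLagrangian.redLagrangian [FiniteDimensional ℝ V] {ω : V →ₗ[ℝ] V →ₗ[ℝ] ℝ}
    (hω : IsSymplectic ω) {S W : Submodule ℝ V} (hS : IsLagrangian ω S)
    (hW : SympOrtho ω W ≤ W) : RedLagrangian ω W S := by
  have h : SympOrtho ω (S ⊓ W) = S ⊔ SympOrtho ω W := by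
    rw [← sympOrtho_sympOrtho hω (S ⊔ SympOrtho ω W), sympOrtho_sup, hS,
      sympOrtho_sympOrtho hω]
  unfold RedLagrangian RedSub
  rw [sympOrtho_sup, h, sympOrtho_sympOrtho hω, inf_eq_right.2 inf_le_right,
    sup_comm, sup_comm S, sup_inf_assoc_of_le S hW]

theorem redSub_eq_self {ω : V →ₗ[ℝ] V →ₗ[ℝ] ℝ} {S W : Submodule ℝ V}
    (hSW : S ≤ W) (hWS : SympOrtho ω W ≤ S) : RedSub ω W S = S := by
  rw [RedSub, inf_eq_left.2 hSW, sup_eq_left.2 hWS]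

theorem redTransverse_of_inf_eq_bot {ω : V →ₗ[ℝ] V →ₗ[ℝ] ℝ} {S T W : Submodule ℝ V}
    (hST : S ⊓ T = ⊥) (hTW : T ≤ W) (hWT : SympOrtho ω W ≤ T) : RedTransverse ω W S T := by
  rw [RedTransverse, redSub_eq_self hTW hWT, RedSub, sup_comm, sup_inf_assoc_of_le _ hWT,
    inf_assoc, inf_eq_right.2 hTW, hST, sup_bot_eq]

/-- Let (V, ω) be a symplectic vector space of dimension 2n, (τ, ν) a polarization,
L a Lagrangian subspace transverse to ν, and W a coisotropic subspace containing ν.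
Then (a) W^⊥ ⊆ ν and the quotient map W → W/W^⊥ restricts to a linear isomorphism of
τ ∩ W onto [τ]^W (injectivity: (τ ⊓ W) ⊓ W^⊥ = ⊥; surjectivity holds by definition of
[τ]^W = ((τ ⊓ W) ⊔ W^⊥)/W^⊥); (b) [τ]^W and [ν]^W are transverse Lagrangians in
[V]^W, and [L]^W is a Lagrangian in [V]^W transverse to [ν]^W; (c) under this
isomorphism the quadratic form of [L]^W with respect to the polarization
([τ]^W, [ν]^W) equals the restriction of L^{(τ,ν)} to τ ∩ W. -/
theorem lagrangian_reduction_quadratic_form [FiniteDimensional ℝ V]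
    (n : ℕ)
    (ω : V →ₗ[ℝ] V →ₗ[ℝ] ℝ) (hω : IsSymplectic ω)
    (hdim : Module.finrank ℝ V = 2 * n)
    (τ ν L W : Submodule ℝ V)
    (hτ : IsLagrangian ω τ) (hν : IsLagrangian ω ν) (hτν : τ ⊓ ν = ⊥)
    (hL : IsLagrangian ω L) (hLν : L ⊓ ν = ⊥)
    (hW : SympOrtho ω W ≤ W) (hνW : ν ≤ W) :
    (SympOrtho ω W ≤ ν ∧ (τ ⊓ W) ⊓ SympOrtho ω W = ⊥ ∧
      (τ ⊓ W) ⊔ SympOrtho ω W = RedSub ω W τ) ∧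
    (RedLagrangian ω W τ ∧ RedLagrangian ω W ν ∧ RedTransverse ω W τ ν ∧
      RedLagrangian ω W L ∧ RedTransverse ω W L ν) ∧
    (∀ x ∈ τ ⊓ W, ∀ m ∈ RedSub ω W ν, x + m ∈ RedSub ω W L →
      ∀ m₀ ∈ ν, x + m₀ ∈ L → ω m x = ω m₀ x) := by
  have hWν : SympOrtho ω W ≤ ν := (sympOrtho_anti ω hνW).trans_eq hν
  refine ⟨⟨hWν, ?_, rfl⟩, ⟨hτ.redLagrangian hω hW, hν.redLagrangian hω hW,
    redTransverse_of_inf_eq_bot hτν hνW hWν, hL.redLagrangian hω hW,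
    redTransverse_of_inf_eq_bot hLν hνW hWν⟩, ?_⟩
  · exact le_bot_iff.1 ((inf_le_inf inf_le_left hWν).trans_eq hτν)
  · intro x hx m hm hxm m₀ hm₀ hxm₀
    rw [redSub_eq_self hνW hWν] at hm
    obtain ⟨l, hl, k, hk, hlk⟩ := Submodule.mem_sup.1 hxm
    have hmem : m - k - m₀ ∈ L ⊓ ν := by
      refine ⟨?_, ν.sub_mem (ν.sub_mem hm (hWν hk)) hm₀⟩
      have heq : m - k - m₀ = l - (x + m₀) := by
        rw [eq_sub_of_add_eq hlk]
        abel
      rw [heq]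
      exact L.sub_mem hl.1 hxm₀
    rw [hLν, Submodule.mem_bot, sub_eq_zero] at hmem
    rw [← hmem, map_sub, LinearMap.sub_apply, mem_sympOrtho.1 hk x hx.2, sub_zero]
end
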